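/- arXiv:1708.09064 — 7 statements merged into one kernel-verified Lean document; each statement's English description precedes it below -/
import Mathlib

section
/- Let n ≥ 1 be an integer. A polynomial p ∈ ℚ[X,Y] of total degree at most n satisfies p(i,j) = 0 for all integers i, j ≥ 0 with i + j < n if and only if p lies in the ℚ-linear span of the polynomials [X]_{n−i}·[Y]_i for i = 0, 1, …, n. -/
open MvPolynomial

/-- The product `[X]_a · [Y]_b` of falling factorials, for `x = (a, b)`. -/
noncomputable def fallingProd (x : ℕ × ℕ) : MvPolynomial (Fin 2) ℚ :=
  Polynomial.aeval (X 0) (descPochhammer ℚ x.1) * Polynomial.aeval (X 1) (descPochhammer ℚ x.2)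

theorem eval_fallingProd (x : ℕ × ℕ) (i j : ℕ) :
    eval ![(i : ℚ), (j : ℚ)] (fallingProd x) = i.descFactorial x.1 * j.descFactorial x.2 := by
  have key (k : Fin 2) (q : Polynomial ℚ) (v : Fin 2 → ℚ) :
      eval v (Polynomial.aeval (X k) q) = q.eval (v k) := by
    rw [← coe_aeval_eq_eval]
    simp only [RingHom.coe_coe, ← Polynomial.aeval_algHom_apply, aeval_X,
      Polynomial.coe_aeval_eq_eval]
  simp [fallingProd, key, descPochhammer_eval_eq_descFactorial]

theorem X_zero_mul_fallingProd (a b : ℕ) :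
    X 0 * fallingProd (a, b) = fallingProd (a + 1, b) + (a : ℚ) • fallingProd (a, b) := by
  simp only [fallingProd, descPochhammer_succ_right, map_mul, map_sub, Polynomial.aeval_X,
    map_natCast, Algebra.smul_def]
  ring

theorem X_one_mul_fallingProd (a b : ℕ) :
    X 1 * fallingProd (a, b) = fallingProd (a, b + 1) + (b : ℚ) • fallingProd (a, b) := by
  simp only [fallingProd, descPochhammer_succ_right, map_mul, map_sub, Polynomial.aeval_X,
    map_natCast, Algebra.smul_def]
  ring

/-- The span of the `[X]_a · [Y]_b` with `a + b ≤ n`. -/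
noncomputable def fallingSpan (n : ℕ) : Submodule ℚ (MvPolynomial (Fin 2) ℚ) :=
  Submodule.span ℚ (fallingProd '' {x | x.1 + x.2 ≤ n})

theorem fallingProd_mem_fallingSpan {a b n : ℕ} (h : a + b ≤ n) :
    fallingProd (a, b) ∈ fallingSpan n :=
  Submodule.subset_span ⟨(a, b), h, rfl⟩

theorem fallingSpan_mono {m n : ℕ} (h : m ≤ n) : fallingSpan m ≤ fallingSpan n :=
  Submodule.span_mono (Set.image_mono fun _ hx => le_trans hx h)

theorem X_mul_mem_fallingSpan (k : Fin 2) {n : ℕ} {p : MvPolynomial (Fin 2) ℚ}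
    (hp : p ∈ fallingSpan n) : X k * p ∈ fallingSpan (n + 1) := by
  induction hp using Submodule.span_induction with
  | mem p hp =>
    obtain ⟨⟨a, b⟩, h, rfl⟩ := hp
    replace h : a + b ≤ n := h
    fin_cases k
    · simp only [Fin.zero_eta, X_zero_mul_fallingProd]
      exact add_mem (fallingProd_mem_fallingSpan (by omega))
        (Submodule.smul_mem _ _ (fallingProd_mem_fallingSpan (by omega)))
    · simp only [Fin.mk_one, X_one_mul_fallingProd]
      exact add_mem (fallingProd_mem_fallingSpan (by omega))
        (Submodule.smul_mem _ _ (fallingProd_mem_fallingSpan (by omega)))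
  | zero => simp
  | add p q _ _ hp hq => rw [mul_add]; exact add_mem hp hq
  | smul c p _ hp => rw [mul_smul_comm]; exact Submodule.smul_mem _ _ hp

theorem X_pow_mul_X_pow_mem_fallingSpan (a b : ℕ) :
    (X 0 ^ a * X 1 ^ b : MvPolynomial (Fin 2) ℚ) ∈ fallingSpan (a + b) := by
  induction a with
  | zero =>
    induction b with
    | zero => simpa [fallingProd] using fallingProd_mem_fallingSpan (le_refl (0 + 0))
    | succ b ih => simpa [pow_succ', mul_assoc] using X_mul_mem_fallingSpan 1 ih
  | succ a ih =>
    simpa [pow_succ', mul_assoc, add_right_comm] using X_mul_mem_fallingSpan 0 ih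

theorem mem_fallingSpan_of_totalDegree_le {n : ℕ} {p : MvPolynomial (Fin 2) ℚ}
    (hp : p.totalDegree ≤ n) : p ∈ fallingSpan n := by
  rw [p.as_sum]
  refine sum_mem fun d hd => ?_
  have hdeg : d 0 + d 1 ≤ n := by
    have := (le_totalDegree hd).trans hp
    simpa [Finsupp.sum_fintype] using this
  rw [monomial_eq, Finsupp.prod_fintype _ _ (by simp), Fin.prod_univ_two, ← smul_eq_C_mul]
  exact Submodule.smul_mem _ _ (fallingSpan_mono hdeg (X_pow_mul_X_pow_mem_fallingSpan _ _))

/-- The coefficients of low degree in the falling factorial basis are determined by the values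
at the lattice points of the triangle. -/
theorem coeff_eq_zero_of_eval_eq_zero {n : ℕ} {S : Finset (ℕ × ℕ)} {c : ℕ × ℕ → ℚ}
    (h : ∀ i j : ℕ, i + j < n → eval ![(i : ℚ), (j : ℚ)] (∑ x ∈ S, c x • fallingProd x) = 0)
    {x : ℕ × ℕ} (hxS : x ∈ S) (hx : x.1 + x.2 < n) : c x = 0 := by
  induction hm : x.1 + x.2 using Nat.strong_induction_on generalizing x with
  | _ m ih =>
    have h0 := h x.1 x.2 hx
    rw [map_sum, Finset.sum_eq_single_of_mem x hxS] at h0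
    · simpa [smul_eval, eval_fallingProd, Nat.descFactorial_self, Nat.factorial_ne_zero] using h0
    · intro y hyS hyx
      rw [smul_eval, eval_fallingProd]
      by_cases h1 : x.1 < y.1
      · simp [Nat.descFactorial_of_lt h1]
      by_cases h2 : x.2 < y.2
      · simp [Nat.descFactorial_of_lt h2]
      have hlt : y.1 + y.2 < m := by
        rcases x with ⟨a, b⟩
        rcases y with ⟨a', b'⟩
        simp only [ne_eq, Prod.mk.injEq] at *
        omega
      simp [ih _ hlt hyS (by omega) rfl]

/-- For `n ≥ 1`, a polynomial `p ∈ ℚ[X,Y]` of total degree at most `n` vanishes at all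
`(i,j)` with `i,j ≥ 0`, `i+j < n` if and only if `p` lies in the span of the
polynomials `[X]_{n−i}·[Y]_i`, `i = 0, …, n`. -/
theorem stmt2 (n : ℕ) (hn : 1 ≤ n) (p : MvPolynomial (Fin 2) ℚ)
    (hp : p.totalDegree ≤ n) :
    (∀ i j : ℕ, i + j < n → eval ![(i : ℚ), (j : ℚ)] p = 0) ↔
      p ∈ Submodule.span ℚ (Set.range (fun i : Fin (n + 1) =>
        Polynomial.aeval (X 0) (descPochhammer ℚ (n - (i : ℕ))) *
        Polynomial.aeval (X 1) (descPochhammer ℚ (i : ℕ)))) := by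
  change _ ↔ p ∈ Submodule.span ℚ
    (Set.range fun i : Fin (n + 1) => fallingProd (n - (i : ℕ), (i : ℕ)))
  constructor
  · intro h
    obtain ⟨l, hl, hlp⟩ := (Finsupp.mem_span_image_iff_linearCombination ℚ).1
      (mem_fallingSpan_of_totalDegree_le hp)
    rw [Finsupp.linearCombination_apply, Finsupp.sum] at hlp
    subst hlp
    refine sum_mem fun x hx => Submodule.smul_mem _ _ (Submodule.subset_span ?_)
    have hle : x.1 + x.2 ≤ n := hl hx
    have hge : n ≤ x.1 + x.2 := not_lt.1 fun hlt =>
      Finsupp.mem_support_iff.1 hx (coeff_eq_zero_of_eval_eq_zero h hx hlt)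
    exact ⟨⟨x.2, by omega⟩, congrArg fallingProd (Prod.ext (by simp only; omega) rfl)⟩
  · intro h i j hij
    clear hp
    induction h using Submodule.span_induction with
    | mem p hp =>
      obtain ⟨k, rfl⟩ := hp
      rw [eval_fallingProd]
      rcases lt_or_ge j k with hj | hj
      · simp [Nat.descFactorial_of_lt hj]
      · have hi : i < n - k := by omega
        simp [Nat.descFactorial_of_lt hi]
    | zero => simp
    | add p q _ _ hp hq => rw [map_add, hp, hq, add_zero]
    | smul c p _ hp => rw [smul_eval, hp, mul_zero]
end

section
/- Let n ≥ 1 and A ≥ 1 be integers, let c_0, …, c_n ∈ ℚ, and let p(X,Y) = Σ_{i=0}^{n} c_i·[X]_{n−i}·[Y]_i ∈ ℚ[X,Y]. Then in ℚ[Y] the identity A·p(−A−1, Y) = (A + n − Y)·p(−A, Y) + Y·p(−A, Y−1) holds. -/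
/-- The two recursions for the falling factorial, combined: `x [x - 1]_k = [x]_k (x - k)`. -/
theorem mul_aeval_sub_one_descPochhammer {R S : Type*} [CommRing R] [CommRing S] [Algebra R S]
    (x : S) (k : ℕ) :
    x * Polynomial.aeval (x - 1) (descPochhammer R k) =
      Polynomial.aeval x (descPochhammer R k) * (x - k) := by
  have h := congrArg (Polynomial.aeval x)
    ((descPochhammer_succ_left R k).symm.trans (descPochhammer_succ_right R k))
  simpa [Polynomial.aeval_comp] using h

/-- For `n ≥ 1`, `A ≥ 1`, rationals `c_0, …, c_n` and
`p(X,Y) = Σ_{i=0}^{n} c_i·[X]_{n−i}·[Y]_i ∈ ℚ[X,Y]`, we have in `ℚ[Y]`: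
`A·p(−A−1, Y) = (A + n − Y)·p(−A, Y) + Y·p(−A, Y−1)`. -/
theorem stmt3 (n : ℕ) (hn : 1 ≤ n) (A : ℤ) (hA : 1 ≤ A) (c : Fin (n + 1) → ℚ)
    (p : MvPolynomial (Fin 2) ℚ)
    (hp : p = ∑ i : Fin (n + 1), MvPolynomial.C (c i) *
      (Polynomial.aeval (MvPolynomial.X 0) (descPochhammer ℚ (n - (i : ℕ))) *
       Polynomial.aeval (MvPolynomial.X 1) (descPochhammer ℚ (i : ℕ)))) :
    Polynomial.C (A : ℚ) * MvPolynomial.aeval ![Polynomial.C (-(A : ℚ) - 1), Polynomial.X] p =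
      (Polynomial.C ((A : ℚ) + (n : ℚ)) - Polynomial.X) *
          MvPolynomial.aeval ![Polynomial.C (-(A : ℚ)), Polynomial.X] p +
        Polynomial.X * MvPolynomial.aeval ![Polynomial.C (-(A : ℚ)), Polynomial.X - 1] p := by
  subst hp
  simp only [map_sum, map_mul, MvPolynomial.aeval_C, Finset.mul_sum, ← Finset.sum_add_distrib,
    ← Polynomial.aeval_algHom_apply, MvPolynomial.aeval_X, Matrix.cons_val_zero,
    Matrix.cons_val_one]
  refine Finset.sum_congr rfl fun i _ => ?_
  have hX := mul_aeval_sub_one_descPochhammer (R := ℚ)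
    (Polynomial.C (-(A : ℚ))) (n - (i : ℕ))
  have hY := mul_aeval_sub_one_descPochhammer (R := ℚ) (Polynomial.X : Polynomial ℚ) (i : ℕ)
  rw [Nat.cast_sub (Nat.lt_succ_iff.mp i.isLt)] at hX
  simp only [Polynomial.C_sub, Polynomial.C_add, Polynomial.C_neg, Polynomial.C_1,
    map_natCast] at hX ⊢
  set c' := algebraMap ℚ (Polynomial ℚ) (c i)
  linear_combination
    (-c' * Polynomial.aeval Polynomial.X (descPochhammer ℚ (i : ℕ))) * hX -
      (c' * Polynomial.aeval (-Polynomial.C (A : ℚ)) (descPochhammer ℚ (n - (i : ℕ)))) * hY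
end

section
/- Let A ≥ 1, n ≥ 1 be integers and let B, β be integers. There exists a polynomial p ∈ ℚ[X,Y] of total degree at most n such that p(i,j) = 0 for all integers i, j ≥ 0 with i + j < n, p(−A, B+j) = 0 for j = 0, 1, …, n−1, and p(−A−1, β) ≠ 0, if and only if both of the following hold: β − B ∉ {1, 2, …, n−1} and A·(β − B) ≠ n·B. -/
open MvPolynomial

theorem succ_mul_ringChoose_succ (x : ℚ) (k : ℕ) :
    ((k : ℚ) + 1) * Ring.choose x (k + 1) = (x - k) * Ring.choose x k := by
  have h := Ring.choose_smul_choose x (Nat.le_succ k)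
  simp only [Nat.succ_eq_add_one, Nat.choose_succ_self_right, Nat.add_sub_cancel_left,
    Ring.choose_one_right, nsmul_eq_mul] at h
  push_cast at h
  rw [h, mul_comm]

theorem succ_mul_ringChoose_succ' (x : ℚ) (k : ℕ) :
    ((k : ℚ) + 1) * Ring.choose x (k + 1) = x * Ring.choose (x - 1) k := by
  have h := Ring.choose_smul_choose x (Nat.le_add_left 1 k)
  simpa only [Nat.choose_one_right, Nat.add_sub_cancel,
    Ring.choose_one_right, nsmul_eq_mul, Nat.cast_add, Nat.cast_one] using h

theorem ringChoose_eq_zero_iff (x : ℚ) (k : ℕ) :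
    Ring.choose x k = 0 ↔ ∃ i < k, x = (i : ℚ) := by
  induction k with
  | zero => simp
  | succ k ih =>
    have hk : (k : ℚ) + 1 ≠ 0 := by positivity
    rw [← mul_eq_zero_iff_left hk, succ_mul_ringChoose_succ, mul_eq_zero, ih, sub_eq_zero]
    constructor
    · rintro (h | ⟨i, hi, h⟩)
      · exact ⟨k, k.lt_succ_self, h⟩
      · exact ⟨i, hi.trans k.lt_succ_self, h⟩
    · rintro ⟨i, hi, h⟩
      rcases Nat.lt_succ_iff_lt_or_eq.mp hi with hi | rfl
      · exact Or.inr ⟨i, hi, h⟩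
      · exact Or.inl h

theorem mul_ringChoose_neg_sub_one (A : ℚ) (k : ℕ) :
    A * Ring.choose (-A - 1) k = (A + k) * Ring.choose (-A) k := by
  linear_combination succ_mul_ringChoose_succ' (-A) k - succ_mul_ringChoose_succ (-A) k

theorem sum_antidiagonal_add_fst_mul_ringChoose (A r s : ℚ) (m : ℕ) :
    ((m : ℚ) + 1) * ∑ ab ∈ Finset.HasAntidiagonal.antidiagonal (m + 1),
      (A + ab.1) * (Ring.choose r ab.1 * Ring.choose s ab.2) =
    (A * (r + s) + (m + 1) * r) * Ring.choose (r + s - 1) m := by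
  have h1 := Ring.add_choose_eq (m + 1) (Commute.all r s)
  have h2 : ∑ ab ∈ Finset.HasAntidiagonal.antidiagonal (m + 1),
      (ab.1 : ℚ) * (Ring.choose r ab.1 * Ring.choose s ab.2) = r * Ring.choose (r + s - 1) m := by
    rw [Finset.Nat.sum_antidiagonal_succ, show r + s - 1 = (r - 1) + s by ring,
      Ring.add_choose_eq m (Commute.all (r - 1) s), Finset.mul_sum]
    simp only [Nat.cast_zero, zero_mul, zero_add]
    refine Finset.sum_congr rfl fun ab _ => ?_
    push_cast
    linear_combination Ring.choose s ab.2 * succ_mul_ringChoose_succ' r ab.1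
  simp only [add_mul A, Finset.sum_add_distrib]
  rw [← Finset.mul_sum, ← h1, h2]
  linear_combination A * succ_mul_ringChoose_succ' (r + s) m

/-- The coefficients of a Newton expansion are determined by the values at `0, 1, 2, …`. -/
theorem newton_coeff_eq_zero {e : ℕ → ℚ} {n m : ℕ} (hmn : m ≤ n)
    (h : ∀ j < m, ∑ b ∈ Finset.range n, e b * Ring.choose (j : ℚ) b = 0) :
    ∀ j < m, e j = 0 := by
  intro j
  induction j using Nat.strong_induction_on with
  | _ j ih =>
    intro hj
    have hs := h j hj
    rw [Finset.sum_eq_single j] at hs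
    · simpa [Ring.choose_natCast] using hs
    · intro b _ hb
      rcases lt_or_gt_of_ne hb with hb | hb
      · rw [ih b hb (hb.trans hj), zero_mul]
      · rw [Ring.choose_natCast, Nat.choose_eq_zero_of_lt hb, Nat.cast_zero, mul_zero]
    · intro hb
      exact absurd (Finset.mem_range.mpr (hj.trans_le hmn)) hb

theorem exists_newton_recenter (e : ℕ → ℚ) (B : ℚ) (n : ℕ) :
    ∃ g : ℕ → ℚ, ∀ y : ℚ, ∑ b ∈ Finset.range n, e b * Ring.choose y b =
      ∑ i ∈ Finset.range n, g i * Ring.choose (y - B) i := by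
  induction n with
  | zero => exact ⟨0, by simp⟩
  | succ n ih =>
    obtain ⟨g, hg⟩ := ih
    refine ⟨fun i => (if i < n then g i else 0) + e n * Ring.choose B (n - i), fun y => ?_⟩
    rw [Finset.sum_range_succ, hg]
    have h := Ring.add_choose_eq n (Commute.all (y - B) B)
    rw [sub_add_cancel, Finset.Nat.sum_antidiagonal_eq_sum_range_succ_mk] at h
    simp only [add_mul, Finset.sum_add_distrib, h, Finset.mul_sum]
    congr 1
    · rw [Finset.sum_range_succ]
      simp only [lt_irrefl, if_false, zero_mul, add_zero]
      exact Finset.sum_congr rfl fun i hi => by rw [if_pos (Finset.mem_range.mp hi)]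
    · exact Finset.sum_congr rfl fun i _ => by ring

/-- A Newton expansion of degree at most `n` vanishing at `B, …, B + n - 1` is a multiple
of the expansion of `Ring.choose (y - B) n`. -/
theorem exists_newton_coeff_eq {e : ℕ → ℚ} {B : ℚ} {n : ℕ}
    (h : ∀ j : ℕ, j < n → ∑ b ∈ Finset.range (n + 1), e b * Ring.choose (B + j) b = 0) :
    ∃ t : ℚ, ∀ b ≤ n, e b = t * Ring.choose (-B) (n - b) := by
  obtain ⟨g, hg⟩ := exists_newton_recenter e B (n + 1)
  have hg0 : ∀ j < n, g j = 0 := newton_coeff_eq_zero n.le_succ fun j hj => by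
    have := h j hj
    rwa [hg, add_sub_cancel_left] at this
  refine ⟨g n, fun b hb => sub_eq_zero.mp ?_⟩
  refine newton_coeff_eq_zero (e := fun b => e b - g n * Ring.choose (-B) (n - b)) le_rfl
    (fun j _ => ?_) b (Nat.lt_succ_of_le hb)
  have hv := Ring.add_choose_eq n (Commute.all (j : ℚ) (-B))
  rw [← sub_eq_add_neg, Finset.Nat.sum_antidiagonal_eq_sum_range_succ_mk] at hv
  simp only [sub_mul, Finset.sum_sub_distrib]
  rw [hg, Finset.sum_range_succ, Finset.sum_eq_zero, hv, zero_add, Finset.mul_sum, sub_eq_zero]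
  · exact Finset.sum_congr rfl fun i _ => by ring
  · intro i hi
    rw [hg0 i (Finset.mem_range.mp hi), zero_mul]

/-- The product of two binomial coefficient functions, indexed by the pair of lower entries. -/
noncomputable def binomialProduct (ab : ℕ × ℕ) : ℚ × ℚ → ℚ :=
  fun v => Ring.choose v.1 ab.1 * Ring.choose v.2 ab.2

/-- The pairs of natural numbers with sum at most `n`. -/
noncomputable def pairsLE (n : ℕ) : Finset (ℕ × ℕ) :=
  (Finset.range (n + 1)).biUnion Finset.HasAntidiagonal.antidiagonal

theorem mem_pairsLE {n : ℕ} {ab : ℕ × ℕ} : ab ∈ pairsLE n ↔ ab.1 + ab.2 ≤ n := by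
  simp [pairsLE]

theorem binomialProduct_natCast (ab : ℕ × ℕ) (i j : ℕ) :
    binomialProduct ab ((i : ℚ), (j : ℚ)) = (i.choose ab.1 : ℚ) * (j.choose ab.2 : ℚ) := by
  simp [binomialProduct, Ring.choose_natCast]

/-- The span of the products of binomial coefficient functions of total degree at most `n`. -/
noncomputable def binomialSpan (n : ℕ) : Submodule ℚ (ℚ × ℚ → ℚ) :=
  Submodule.span ℚ (binomialProduct '' (pairsLE n : Set (ℕ × ℕ)))

theorem binomialProduct_mem {ab : ℕ × ℕ} {n : ℕ} (h : ab.1 + ab.2 ≤ n) :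
    binomialProduct ab ∈ binomialSpan n :=
  Submodule.subset_span ⟨ab, mem_pairsLE.mpr h, rfl⟩

theorem binomialSpan_mono {m n : ℕ} (h : m ≤ n) : binomialSpan m ≤ binomialSpan n :=
  Submodule.span_mono <| Set.image_mono fun _ hab =>
    mem_pairsLE.mpr ((mem_pairsLE.mp hab).trans h)

theorem fst_mul_mem_binomialSpan {f : ℚ × ℚ → ℚ} {n : ℕ} (hf : f ∈ binomialSpan n) :
    Prod.fst * f ∈ binomialSpan (n + 1) := by
  induction hf using Submodule.span_induction with
  | mem f hf =>
    obtain ⟨⟨a, b⟩, hab, rfl⟩ := hf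
    have hab : a + b ≤ n := mem_pairsLE.mp hab
    have h : Prod.fst * binomialProduct (a, b) =
        ((a : ℚ) + 1) • binomialProduct (a + 1, b) + (a : ℚ) • binomialProduct (a, b) := by
      ext v
      simp only [binomialProduct, Pi.mul_apply, Pi.add_apply, Pi.smul_apply, smul_eq_mul]
      linear_combination -Ring.choose v.2 b * succ_mul_ringChoose_succ v.1 a
    rw [h]
    exact add_mem (Submodule.smul_mem _ _ (binomialProduct_mem (by simp only; omega)))
      (Submodule.smul_mem _ _ (binomialProduct_mem (by simp only; omega)))
  | zero => simp
  | add f g _ _ hf hg => rw [mul_add]; exact add_mem hf hg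
  | smul c f _ hf => rw [mul_smul_comm]; exact Submodule.smul_mem _ _ hf

theorem snd_mul_mem_binomialSpan {f : ℚ × ℚ → ℚ} {n : ℕ} (hf : f ∈ binomialSpan n) :
    Prod.snd * f ∈ binomialSpan (n + 1) := by
  induction hf using Submodule.span_induction with
  | mem f hf =>
    obtain ⟨⟨a, b⟩, hab, rfl⟩ := hf
    have hab : a + b ≤ n := mem_pairsLE.mp hab
    have h : Prod.snd * binomialProduct (a, b) =
        ((b : ℚ) + 1) • binomialProduct (a, b + 1) + (b : ℚ) • binomialProduct (a, b) := by
      ext v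
      simp only [binomialProduct, Pi.mul_apply, Pi.add_apply, Pi.smul_apply, smul_eq_mul]
      linear_combination -Ring.choose v.1 a * succ_mul_ringChoose_succ v.2 b
    rw [h]
    exact add_mem (Submodule.smul_mem _ _ (binomialProduct_mem (by simp only; omega)))
      (Submodule.smul_mem _ _ (binomialProduct_mem (by simp only; omega)))
  | zero => simp
  | add f g _ _ hf hg => rw [mul_add]; exact add_mem hf hg
  | smul c f _ hf => rw [mul_smul_comm]; exact Submodule.smul_mem _ _ hf

theorem fst_pow_mul_snd_pow_mem_binomialSpan (a b : ℕ) :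
    (Prod.fst ^ a * Prod.snd ^ b : ℚ × ℚ → ℚ) ∈ binomialSpan (a + b) := by
  induction a with
  | zero =>
    induction b with
    | zero =>
      convert binomialProduct_mem (ab := (0, 0)) (le_refl 0) using 1
      ext v
      simp [binomialProduct]
    | succ b ih =>
      rw [pow_succ', mul_left_comm]
      exact snd_mul_mem_binomialSpan ih
  | succ a ih =>
    rw [pow_succ', mul_assoc, Nat.add_right_comm]
    exact fst_mul_mem_binomialSpan ih

theorem eval_mem_binomialSpan {p : MvPolynomial (Fin 2) ℚ} {n : ℕ} (hp : p.totalDegree ≤ n) :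
    (fun v : ℚ × ℚ => eval ![v.1, v.2] p) ∈ binomialSpan n := by
  have h : (fun v : ℚ × ℚ => eval ![v.1, v.2] p) =
      ∑ d ∈ p.support, p.coeff d • (Prod.fst ^ d 0 * Prod.snd ^ d 1 : ℚ × ℚ → ℚ) := by
    ext v
    simp [eval_eq', Fin.prod_univ_two]
  rw [h]
  refine sum_mem fun d hd => Submodule.smul_mem _ _
    (binomialSpan_mono ?_ (fst_pow_mul_snd_pow_mem_binomialSpan _ _))
  have := (le_totalDegree hd).trans hp
  rwa [Finsupp.sum_fintype _ _ (fun _ => rfl), Fin.sum_univ_two] at this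

/-- A bivariate polynomial of degree at most `n` vanishing on the triangle `i + j < n` is a
combination of the products of binomial coefficients of total degree exactly `n`. -/
theorem exists_eval_eq_sum_antidiagonal {p : MvPolynomial (Fin 2) ℚ} {n : ℕ}
    (hp : p.totalDegree ≤ n)
    (h : ∀ i j : ℕ, i + j < n → eval ![(i : ℚ), (j : ℚ)] p = 0) :
    ∃ c : ℕ × ℕ → ℚ, ∀ x y : ℚ, eval ![x, y] p =
      ∑ ab ∈ Finset.HasAntidiagonal.antidiagonal n, c ab * (Ring.choose x ab.1 * Ring.choose y ab.2) := by
  obtain ⟨c, hc⟩ :=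
    (Submodule.mem_span_image_finset_iff_exists_fun' ℚ).mp (eval_mem_binomialSpan hp)
  have hev (x y : ℚ) : eval ![x, y] p = ∑ ab ∈ pairsLE n, c ab * binomialProduct ab (x, y) := by
    simpa using (congrFun hc (x, y)).symm
  have hc0 (k : ℕ) : ∀ ab : ℕ × ℕ, ab.1 + ab.2 = k → k < n → c ab = 0 := by
    induction k using Nat.strong_induction_on with
    | _ k ih =>
      rintro ⟨i, j⟩ hij hk
      simp only at hij
      have hs := h i j (by omega)
      rw [hev, Finset.sum_eq_single (i, j)] at hs
      · simpa [binomialProduct_natCast] using hs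
      · rintro ⟨a, b⟩ _ hne
        rw [binomialProduct_natCast]
        rcases lt_or_ge i a with ha | ha
        · simp [Nat.choose_eq_zero_of_lt ha]
        rcases lt_or_ge j b with hb | hb
        · simp [Nat.choose_eq_zero_of_lt hb]
        have hlt : a + b < k := by
          rw [Ne, Prod.mk.injEq] at hne
          omega
        rw [ih (a + b) hlt (a, b) rfl (hlt.trans hk), zero_mul]
      · exact fun hm => absurd (mem_pairsLE.mpr (by simp only; omega)) hm
  refine ⟨c, fun x y => ?_⟩
  rw [hev]
  symm
  refine Finset.sum_subset (fun ab hab => mem_pairsLE.mpr (Finset.HasAntidiagonal.mem_antidiagonal.mp hab).le)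
    fun ab hab hn => ?_
  rw [hc0 _ ab rfl (lt_of_le_of_ne (mem_pairsLE.mp hab) fun he =>
    hn (Finset.HasAntidiagonal.mem_antidiagonal.mpr he)), zero_mul]

theorem exists_eval_eq_ringChoose {σ : Type*} (i : σ) (k : ℕ) :
    ∃ P : MvPolynomial σ ℚ, P.totalDegree ≤ k ∧ ∀ v, eval v P = Ring.choose (v i) k := by
  induction k with
  | zero => exact ⟨1, by simp, by simp⟩
  | succ k ih =>
    obtain ⟨P, hP, hv⟩ := ih
    refine ⟨C ((k : ℚ) + 1)⁻¹ * ((X i - C (k : ℚ)) * P), ?_, fun v => ?_⟩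
    · refine (totalDegree_mul _ _).trans ?_
      rw [totalDegree_C, zero_add]
      refine (totalDegree_mul _ _).trans ?_
      have := totalDegree_sub_C_le (X i : MvPolynomial σ ℚ) (k : ℚ)
      rw [totalDegree_X] at this
      omega
    · have hk : (k : ℚ) + 1 ≠ 0 := by positivity
      simp only [map_mul, map_sub, eval_C, eval_X, hv]
      rw [← succ_mul_ringChoose_succ, inv_mul_cancel_left₀ hk]

theorem exists_eval_eq_sum_ringChoose (c : ℕ × ℕ → ℚ) (n : ℕ) :
    ∃ p : MvPolynomial (Fin 2) ℚ, p.totalDegree ≤ n ∧ ∀ x y : ℚ, eval ![x, y] p =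
      ∑ ab ∈ Finset.HasAntidiagonal.antidiagonal n, c ab * (Ring.choose x ab.1 * Ring.choose y ab.2) := by
  choose P hP hPv using exists_eval_eq_ringChoose (0 : Fin 2)
  choose Q hQ hQv using exists_eval_eq_ringChoose (1 : Fin 2)
  refine ⟨∑ ab ∈ Finset.HasAntidiagonal.antidiagonal n, C (c ab) * (P ab.1 * Q ab.2), ?_, fun x y => ?_⟩
  · refine totalDegree_finsetSum_le fun ab hab => (totalDegree_mul _ _).trans ?_
    rw [totalDegree_C, zero_add]
    refine (totalDegree_mul _ _).trans ?_
    rw [← Finset.HasAntidiagonal.mem_antidiagonal.mp hab]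
    exact add_le_add (hP _) (hQ _)
  · simp [hPv, hQv]

/-- Two-dimensional nonvanishing criterion: for integers `A ≥ 1`, `n ≥ 1`, `B`, `β`,
there exists `p ∈ ℚ[X,Y]` of total degree at most `n` vanishing on
`S_3 = {(i,j) : i,j ≥ 0, i+j < n}` and `S_2 = {(−A, B+j) : 0 ≤ j ≤ n−1}` but not at
`(−A−1, β)`, if and only if `β − B ∉ {1, …, n−1}` and `A·(β − B) ≠ n·B`. -/
theorem stmt5 (A : ℤ) (hA : 1 ≤ A) (n : ℕ) (hn : 1 ≤ n) (B β : ℤ) :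
    (∃ p : MvPolynomial (Fin 2) ℚ, p.totalDegree ≤ n ∧
      (∀ i j : ℕ, i + j < n → eval ![(i : ℚ), (j : ℚ)] p = 0) ∧
      (∀ j : ℕ, j < n → eval ![-(A : ℚ), (B : ℚ) + (j : ℚ)] p = 0) ∧
      eval ![-(A : ℚ) - 1, (β : ℚ)] p ≠ 0) ↔
    ((∀ k : ℤ, 1 ≤ k → k ≤ (n : ℤ) - 1 → β - B ≠ k) ∧ A * (β - B) ≠ (n : ℤ) * B) := by
  obtain ⟨m, rfl⟩ : ∃ m, n = m + 1 := ⟨n - 1, by omega⟩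
  have hA0 : (A : ℚ) ≠ 0 := by exact_mod_cast (by omega : A ≠ 0)
  have hm : (m : ℚ) + 1 ≠ 0 := by positivity
  have hchA (k : ℕ) : Ring.choose (-(A : ℚ)) k ≠ 0 := by
    rw [Ne, ringChoose_eq_zero_iff]
    rintro ⟨i, -, hi⟩
    have : -A = (i : ℤ) := by exact_mod_cast hi
    omega
  have hW := sum_antidiagonal_add_fst_mul_ringChoose (A : ℚ) (-(B : ℚ)) (β : ℚ) m
  set W := ∑ ab ∈ Finset.HasAntidiagonal.antidiagonal (m + 1),
    ((A : ℚ) + ab.1) * (Ring.choose (-(B : ℚ)) ab.1 * Ring.choose (β : ℚ) ab.2)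
  have hiff : W ≠ 0 ↔ ((∀ k : ℤ, 1 ≤ k → k ≤ ((m + 1 : ℕ) : ℤ) - 1 → β - B ≠ k) ∧
      A * (β - B) ≠ ((m + 1 : ℕ) : ℤ) * B) := by
    have h1 : (A : ℚ) * (-B + β) + (m + 1) * -B = 0 ↔ A * (β - B) = ((m + 1 : ℕ) : ℤ) * B := by
      rw [← sub_eq_zero (a := A * (β - B)), ← Int.cast_eq_zero (α := ℚ)]
      push_cast
      ring_nf
    have h2 : Ring.choose (-(B : ℚ) + β - 1) m = 0 ↔
        ∃ k : ℤ, 1 ≤ k ∧ k ≤ ((m + 1 : ℕ) : ℤ) - 1 ∧ β - B = k := by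
      rw [ringChoose_eq_zero_iff]
      constructor
      · rintro ⟨i, hi, h⟩
        have h' : -B + β - 1 = (i : ℤ) := by exact_mod_cast h
        exact ⟨i + 1, by omega, by omega, by omega⟩
      · rintro ⟨k, hk1, hk2, h⟩
        obtain ⟨i, rfl⟩ : ∃ i : ℕ, k = i + 1 := ⟨(k - 1).toNat, by omega⟩
        refine ⟨i, by omega, ?_⟩
        exact_mod_cast (by omega : -B + β - 1 = (i : ℤ))
    rw [← mul_ne_zero_iff_left hm, hW, mul_ne_zero_iff, Ne, Ne, h1, h2, and_comm]
    push Not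
    rfl
  rw [← hiff]
  have key (c : ℕ × ℕ → ℚ) (t : ℚ) (hc : ∀ ab ∈ Finset.HasAntidiagonal.antidiagonal (m + 1),
      c ab * Ring.choose (-(A : ℚ)) ab.1 = t * Ring.choose (-(B : ℚ)) ab.1) :
      (A : ℚ) * ∑ ab ∈ Finset.HasAntidiagonal.antidiagonal (m + 1),
        c ab * (Ring.choose (-(A : ℚ) - 1) ab.1 * Ring.choose (β : ℚ) ab.2) = t * W := by
    simp only [W, Finset.mul_sum]
    refine Finset.sum_congr rfl fun ab hab => ?_
    linear_combination c ab * Ring.choose (β : ℚ) ab.2 * mul_ringChoose_neg_sub_one (A : ℚ) ab.1 +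
      (A + ab.1) * Ring.choose (β : ℚ) ab.2 * hc ab hab
  constructor
  · rintro ⟨p, hp, h3, h2, h1⟩ hW0
    obtain ⟨c, hc⟩ := exists_eval_eq_sum_antidiagonal hp h3
    obtain ⟨t, ht⟩ := exists_newton_coeff_eq (B := (B : ℚ)) (n := m + 1)
      (e := fun b => c (m + 1 - b, b) * Ring.choose (-(A : ℚ)) (m + 1 - b)) fun j hj => by
        have h := h2 j hj
        rw [hc, ← Finset.Nat.sum_antidiagonal_swap,
          Finset.Nat.sum_antidiagonal_eq_sum_range_succ_mk] at h
        simpa only [Prod.swap_prod_mk, mul_assoc] using h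
    have hk := key c t fun ab hab => by
      obtain ⟨a, b⟩ := ab
      have hab : a + b = m + 1 := Finset.HasAntidiagonal.mem_antidiagonal.mp hab
      simpa [← hab] using ht b (by omega)
    rw [← hc, hW0, mul_zero] at hk
    exact h1 ((mul_eq_zero.mp hk).resolve_left hA0)
  · intro hW0
    obtain ⟨p, hp, hev⟩ := exists_eval_eq_sum_ringChoose
      (fun ab => Ring.choose (-(B : ℚ)) ab.1 / Ring.choose (-(A : ℚ)) ab.1) (m + 1)
    refine ⟨p, hp, fun i j hij => ?_, fun j hj => ?_, fun h => hW0 ?_⟩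
    · rw [hev]
      refine Finset.sum_eq_zero fun ab hab => ?_
      rw [Finset.HasAntidiagonal.mem_antidiagonal] at hab
      rw [Ring.choose_natCast, Ring.choose_natCast]
      rcases lt_or_ge i ab.1 with ha | ha
      · simp [Nat.choose_eq_zero_of_lt ha]
      · simp [Nat.choose_eq_zero_of_lt (show j < ab.2 by omega)]
    · have hv := Ring.add_choose_eq (m + 1) (Commute.all (-(B : ℚ)) (B + j))
      rw [neg_add_cancel_left, Ring.choose_natCast, Nat.choose_eq_zero_of_lt hj,
        Nat.cast_zero] at hv
      rw [hev, hv]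
      refine Finset.sum_congr rfl fun ab _ => ?_
      rw [← mul_assoc, div_mul_cancel₀ _ (hchA _)]
    · have hk := key (fun ab => Ring.choose (-(B : ℚ)) ab.1 / Ring.choose (-(A : ℚ)) ab.1) 1
        fun ab _ => by rw [one_mul, div_mul_cancel₀ _ (hchA ab.1)]
      rw [hev] at h
      rw [h, mul_zero, one_mul] at hk
      exact hk.symm
end

section
/- Let n ≥ 2 and d be integers with 0 < d < n, and let A, B, C be integers. Then in ℚ[Y,Z] the identity (A + n − Y − Z)·[Y−B]_d·[Z−C]_{n−d} + Y·[Y−B−1]_d·[Z−C]_{n−d} + Z·[Y−B]_d·[Z−C−1]_{n−d} = [Y−B−1]_{d−1}·[Z−C−1]_{n−d−1}·(A·(Y−B)·(Z−C) − d·B·(Z−C) − (n−d)·C·(Y−B)) holds. -/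
theorem aeval_descPochhammer_succ_left {R S : Type*} [CommRing R] [CommRing S] [Algebra R S]
    (k : ℕ) (u : S) :
    Polynomial.aeval u (descPochhammer R (k + 1)) =
      u * Polynomial.aeval (u - 1) (descPochhammer R k) := by
  simp [descPochhammer_succ_left, Polynomial.aeval_comp]

theorem aeval_descPochhammer_succ_right {R S : Type*} [CommRing R] [CommRing S] [Algebra R S]
    (k : ℕ) (u : S) :
    Polynomial.aeval u (descPochhammer R (k + 1)) =
      Polynomial.aeval u (descPochhammer R k) * (u - k) := by
  simp [descPochhammer_succ_right]


/-- For integers `n ≥ 2`, `0 < d < n` and `A, B, C`, in `ℚ[Y,Z]` we have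
`(A+n−Y−Z)·[Y−B]_d·[Z−C]_{n−d} + Y·[Y−B−1]_d·[Z−C]_{n−d} + Z·[Y−B]_d·[Z−C−1]_{n−d}`
`= [Y−B−1]_{d−1}·[Z−C−1]_{n−d−1}·(A·(Y−B)·(Z−C) − d·B·(Z−C) − (n−d)·C·(Y−B))`. -/
theorem stmt10 (n d : ℕ) (hn : 2 ≤ n) (hd0 : 0 < d) (hdn : d < n) (A B C : ℤ) :
    (MvPolynomial.C ((A : ℚ) + (n : ℚ)) - MvPolynomial.X 0 - MvPolynomial.X 1) *
          Polynomial.aeval (MvPolynomial.X 0 - MvPolynomial.C (B : ℚ)) (descPochhammer ℚ d) *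
          Polynomial.aeval (MvPolynomial.X 1 - MvPolynomial.C (C : ℚ))
            (descPochhammer ℚ (n - d)) +
        MvPolynomial.X 0 *
          Polynomial.aeval (MvPolynomial.X 0 - MvPolynomial.C (B : ℚ) - 1)
            (descPochhammer ℚ d) *
          Polynomial.aeval (MvPolynomial.X 1 - MvPolynomial.C (C : ℚ))
            (descPochhammer ℚ (n - d)) +
        MvPolynomial.X 1 *
          Polynomial.aeval (MvPolynomial.X 0 - MvPolynomial.C (B : ℚ)) (descPochhammer ℚ d) *
          Polynomial.aeval (MvPolynomial.X 1 - MvPolynomial.C (C : ℚ) - 1)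
            (descPochhammer ℚ (n - d)) =
      Polynomial.aeval (MvPolynomial.X 0 - MvPolynomial.C (B : ℚ) - 1)
          (descPochhammer ℚ (d - 1)) *
        Polynomial.aeval (MvPolynomial.X 1 - MvPolynomial.C (C : ℚ) - 1)
          (descPochhammer ℚ (n - d - 1)) *
        (MvPolynomial.C (A : ℚ) * (MvPolynomial.X 0 - MvPolynomial.C (B : ℚ)) *
            (MvPolynomial.X 1 - MvPolynomial.C (C : ℚ)) -
          MvPolynomial.C ((d : ℚ) * (B : ℚ)) * (MvPolynomial.X 1 - MvPolynomial.C (C : ℚ)) -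
          MvPolynomial.C (((n : ℚ) - (d : ℚ)) * (C : ℚ)) *
            (MvPolynomial.X 0 - MvPolynomial.C (B : ℚ))) := by
  obtain ⟨k, rfl⟩ := Nat.exists_eq_add_of_lt hd0
  obtain ⟨m, rfl⟩ := Nat.exists_eq_add_of_lt hdn
  have hm : 0 + k + 1 + m + 1 - (0 + k + 1) = m + 1 := by omega
  rw [hm, zero_add, Nat.add_sub_cancel, Nat.add_sub_cancel]
  rw [aeval_descPochhammer_succ_left k (MvPolynomial.X 0 - MvPolynomial.C (B : ℚ)),
    aeval_descPochhammer_succ_left m (MvPolynomial.X 1 - MvPolynomial.C (C : ℚ)),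
    aeval_descPochhammer_succ_right k (MvPolynomial.X 0 - MvPolynomial.C (B : ℚ) - 1),
    aeval_descPochhammer_succ_right m (MvPolynomial.X 1 - MvPolynomial.C (C : ℚ) - 1)]
  simp only [map_add, map_sub, map_mul, map_natCast, Nat.cast_add, Nat.cast_one, map_one]
  ring
end

section
/- Let A ≥ 1, n ≥ 1 be integers and let B, C, β, γ be integers. Set β̄ = β − B and γ̄ = γ − C. Define rational numbers v_d for d = 0, 1, …, n by: v_0 = [γ̄−1]_{n−1}·(A·γ̄ − n·C), v_n = [β̄−1]_{n−1}·(A·β̄ − n·B), and for 0 < d < n, v_d = [β̄−1]_{d−1}·[γ̄−1]_{n−d−1}·(A·β̄·γ̄ − d·B·γ̄ − (n−d)·C·β̄). Then there exists d ∈ {0, 1, …, n} with v_d ≠ 0 if and only if all of the following hold: (1) (β̄, γ̄) ≠ (i, j) for all integers i, j ≥ 1 with i + j < n; (2) (A·β̄, A·γ̄) ≠ (n·B, n·C); (3a) if β̄ = 0 and 0 < γ̄ < n then B ≠ 0; (3b) if γ̄ = 0 and 0 < β̄ < n then C ≠ 0; (3c) if β̄ + γ̄ = n and 0 < β̄ <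 n and 0 < γ̄ < n then B + C ≠ A. -/
theorem descPochhammer_eval_intCast_sub_one_eq_zero_iff (k : ℕ) (x : ℤ) :
    (descPochhammer ℚ k).eval ((x : ℚ) - 1) = 0 ↔ 1 ≤ x ∧ x ≤ k := by
  induction k with
  | zero => simp; omega
  | succ k ih =>
    have hx : (x : ℚ) - 1 - k = 0 ↔ x = k + 1 := by
      rw [sub_sub, sub_eq_zero, add_comm]
      exact_mod_cast Iff.rfl
    rw [descPochhammer_succ_eval, mul_eq_zero, ih, hx]
    push_cast
    omega

theorem mul_eq_mul_of_proportional {A B C b c n : ℤ} (hA : 1 ≤ A) (hc : c ≠ 0)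
    (h₁ : A * c = n * C) (h₂ : B * c = C * b) : A * b = n * B := by
  have hC : C ≠ 0 := by
    rintro rfl
    simp only [mul_zero, mul_eq_zero] at h₁
    omega
  apply mul_left_cancel₀ hC
  linear_combination (-A) * h₂ + B * h₁

theorem forall_factor_vanishing_iff {A B C b c n : ℤ} (hA : 1 ≤ A) (hn : 1 ≤ n) :
    (((1 ≤ c ∧ c ≤ n - 1) ∨ A * c = n * C) ∧ ((1 ≤ b ∧ b ≤ n - 1) ∨ A * b = n * B) ∧
      ∀ d : ℤ, 0 < d → d < n → (1 ≤ b ∧ b ≤ d - 1) ∨ (1 ≤ c ∧ c ≤ n - d - 1) ∨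
        A * b * c - d * B * c - (n - d) * C * b = 0) ↔
      (1 ≤ b ∧ 1 ≤ c ∧ b + c < n) ∨ (A * b = n * B ∧ A * c = n * C) ∨
        (b = 0 ∧ 0 < c ∧ c < n ∧ B = 0) ∨ (c = 0 ∧ 0 < b ∧ b < n ∧ C = 0) ∨
        (b + c = n ∧ 0 < b ∧ b < n ∧ 0 < c ∧ c < n ∧ B + C = A) := by
  constructor
  · rintro ⟨h0, hn', hd⟩
    by_cases hb : 1 ≤ b ∧ b ≤ n - 1
    · by_cases hc : 1 ≤ c ∧ c ≤ n - 1
      · rcases lt_trichotomy (b + c) n with h | h | h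
        · exact Or.inl ⟨hb.1, hc.1, h⟩
        · have hL := (hd b (by omega) (by omega)).resolve_left (by omega) |>.resolve_left (by omega)
          have hABC : B + C = A := by
            have hbc : b * c ≠ 0 := mul_ne_zero (by omega) (by omega)
            apply mul_left_cancel₀ hbc
            linear_combination (-1) * hL + C * b * h
          omega
        · have hL₁ := (hd b (by omega) (by omega)).resolve_left (by omega)
            |>.resolve_left (by omega)
          have hL₂ := (hd (n - c) (by omega) (by omega)).resolve_left (by omega)
            |>.resolve_left (by omega)
          have hBC : B * c = C * b := by
            have : b + c - n ≠ 0 := by omega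
            apply mul_left_cancel₀ this
            linear_combination hL₂ - hL₁
          have hAc : A * c = n * C := by
            have hb0 : b ≠ 0 := by omega
            apply mul_left_cancel₀ hb0
            linear_combination hL₁ + b * hBC
          exact Or.inr (Or.inl ⟨mul_eq_mul_of_proportional hA (by omega) hAc hBC, hAc⟩)
      · have hAc := h0.resolve_left hc
        have hL := (hd 1 (by omega) (by omega)).resolve_left (by omega) |>.resolve_left (by omega)
        rcases eq_or_ne c 0 with rfl | hc0
        · have hC : C = 0 := by
            rw [mul_zero] at hAc
            exact (mul_eq_zero.mp hAc.symm).resolve_left (by omega)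
          omega
        · exact Or.inr (Or.inl ⟨mul_eq_mul_of_proportional hA hc0 hAc
            (by linear_combination b * hAc - hL), hAc⟩)
    · have hAb := hn'.resolve_left hb
      by_cases hc : 1 ≤ c ∧ c ≤ n - 1
      · have hL := (hd (n - 1) (by omega) (by omega)).resolve_left (by omega)
          |>.resolve_left (by omega)
        rcases eq_or_ne b 0 with rfl | hb0
        · have hB : B = 0 := by
            rw [mul_zero] at hAb
            exact (mul_eq_zero.mp hAb.symm).resolve_left (by omega)
          omega
        · exact Or.inr (Or.inl ⟨hAb, mul_eq_mul_of_proportional hA hb0 hAb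
            (by linear_combination c * hAb - hL)⟩)
      · exact Or.inr (Or.inl ⟨hAb, h0.resolve_left hc⟩)
  · rintro (h | ⟨hAb, hAc⟩ | ⟨rfl, h₁, h₂, rfl⟩ | ⟨rfl, h₁, h₂, rfl⟩ | ⟨h, hb, hb', hc, hc', rfl⟩)
    · exact ⟨by omega, by omega, fun d _ _ ↦ by omega⟩
    · refine ⟨Or.inr hAc, Or.inr hAb, fun d _ _ ↦ Or.inr (Or.inr ?_)⟩
      have hA0 : A ≠ 0 := by omega
      apply mul_left_cancel₀ hA0
      linear_combination (A * c - (n - d) * C) * hAb + (n * B - d * B) * hAc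
    · exact ⟨by omega, by simp, fun d _ _ ↦ by simp⟩
    · exact ⟨by simp, by omega, fun d _ _ ↦ by simp⟩
    · refine ⟨by omega, by omega, fun d _ _ ↦ ?_⟩
      rcases lt_trichotomy d b with hdb | rfl | hdb
      · omega
      · refine Or.inr (Or.inr ?_)
        linear_combination C * d * h
      · omega


/-- Nonvanishing criterion for the values `v_d = A·p_d(−A−1, β, γ)` in the
three-dimensional derivative lemma. With `β̄ = β − B`, `γ̄ = γ − C`,
`v_0 = [γ̄−1]_{n−1}·(A·γ̄ − n·C)`, `v_n = [β̄−1]_{n−1}·(A·β̄ − n·B)`, and for `0<d<n`,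
`v_d = [β̄−1]_{d−1}·[γ̄−1]_{n−d−1}·(A·β̄·γ̄ − d·B·γ̄ − (n−d)·C·β̄)`, some `v_d` with
`0 ≤ d ≤ n` is nonzero if and only if conditions (1), (2), (3a), (3b), (3c) hold. -/
theorem stmt12 (A : ℤ) (hA : 1 ≤ A) (n : ℕ) (hn : 1 ≤ n) (B C β γ : ℤ)
    (v : ℕ → ℚ)
    (hv0 : v 0 = (descPochhammer ℚ (n - 1)).eval (((γ - C : ℤ) : ℚ) - 1) *
      ((A : ℚ) * ((γ - C : ℤ) : ℚ) - (n : ℚ) * (C : ℚ)))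
    (hvn : v n = (descPochhammer ℚ (n - 1)).eval (((β - B : ℤ) : ℚ) - 1) *
      ((A : ℚ) * ((β - B : ℤ) : ℚ) - (n : ℚ) * (B : ℚ)))
    (hvd : ∀ d : ℕ, 0 < d → d < n →
      v d = (descPochhammer ℚ (d - 1)).eval (((β - B : ℤ) : ℚ) - 1) *
        (descPochhammer ℚ (n - d - 1)).eval (((γ - C : ℤ) : ℚ) - 1) *
        ((A : ℚ) * ((β - B : ℤ) : ℚ) * ((γ - C : ℤ) : ℚ) -
          (d : ℚ) * (B : ℚ) * ((γ - C : ℤ) : ℚ) -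
          ((n : ℚ) - (d : ℚ)) * (C : ℚ) * ((β - B : ℤ) : ℚ))) :
    (∃ d : ℕ, d ≤ n ∧ v d ≠ 0) ↔
      ((∀ i j : ℤ, 1 ≤ i → 1 ≤ j → i + j < (n : ℤ) → (β - B, γ - C) ≠ (i, j)) ∧
        (A * (β - B), A * (γ - C)) ≠ ((n : ℤ) * B, (n : ℤ) * C) ∧
        (β - B = 0 → 0 < γ - C → γ - C < (n : ℤ) → B ≠ 0) ∧
        (γ - C = 0 → 0 < β - B → β - B < (n : ℤ) → C ≠ 0) ∧
        ((β - B) + (γ - C) = (n : ℤ) → 0 < β - B → β - B < (n : ℤ) →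
          0 < γ - C → γ - C < (n : ℤ) → B + C ≠ A)) := by
  generalize β - B = b at *
  generalize γ - C = c at *
  have h0 : v 0 = 0 ↔ (1 ≤ c ∧ c ≤ (n : ℤ) - 1) ∨ A * c = n * C := by
    rw [hv0, mul_eq_zero, descPochhammer_eval_intCast_sub_one_eq_zero_iff, Nat.cast_sub hn,
      sub_eq_zero, Nat.cast_one]
    norm_cast
  have hn' : v n = 0 ↔ (1 ≤ b ∧ b ≤ (n : ℤ) - 1) ∨ A * b = n * B := by
    rw [hvn, mul_eq_zero, descPochhammer_eval_intCast_sub_one_eq_zero_iff, Nat.cast_sub hn,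
      sub_eq_zero, Nat.cast_one]
    norm_cast
  have hd : ∀ d : ℕ, 0 < d → d < n → (v d = 0 ↔ (1 ≤ b ∧ b ≤ (d : ℤ) - 1) ∨
      (1 ≤ c ∧ c ≤ (n : ℤ) - d - 1) ∨ A * b * c - d * B * c - (n - d) * C * b = 0) := by
    intro d hd0 hdn
    rw [hvd d hd0 hdn, mul_eq_zero, mul_eq_zero, or_assoc,
      descPochhammer_eval_intCast_sub_one_eq_zero_iff,
      descPochhammer_eval_intCast_sub_one_eq_zero_iff, Nat.cast_sub (by omega),
      Nat.cast_sub (by omega), Nat.cast_sub (by omega), Nat.cast_one]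
    norm_cast
  have hall : (∀ d ≤ n, v d = 0) ↔ ((1 ≤ c ∧ c ≤ (n : ℤ) - 1) ∨ A * c = n * C) ∧
      ((1 ≤ b ∧ b ≤ (n : ℤ) - 1) ∨ A * b = n * B) ∧
      ∀ d : ℤ, 0 < d → d < n → (1 ≤ b ∧ b ≤ d - 1) ∨ (1 ≤ c ∧ c ≤ (n : ℤ) - d - 1) ∨
        A * b * c - d * B * c - (n - d) * C * b = 0 := by
    constructor
    · intro h
      refine ⟨h0.mp (h 0 n.zero_le), hn'.mp (h n le_rfl), fun d hd0 hdn ↦ ?_⟩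
      lift d to ℕ using hd0.le
      exact (hd d (by omega) (by omega)).mp (h d (by omega))
    · rintro ⟨h₁, h₂, h₃⟩ d hdn
      rcases Nat.eq_zero_or_pos d with rfl | hd0
      · exact h0.mpr h₁
      rcases hdn.eq_or_lt with rfl | hdn
      · exact hn'.mpr h₂
      · exact (hd d hd0 hdn).mpr (h₃ d (by omega) (by omega))
  have hex : (∃ d ≤ n, v d ≠ 0) ↔ ¬∀ d ≤ n, v d = 0 := by push Not; rfl
  rw [hex, hall, forall_factor_vanishing_iff hA (by omega)]
  have hpairs : (∀ i j : ℤ, 1 ≤ i → 1 ≤ j → i + j < (n : ℤ) → (b, c) ≠ (i, j)) ↔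
      ¬(1 ≤ b ∧ 1 ≤ c ∧ b + c < n) := by
    constructor
    · rintro h ⟨h₁, h₂, h₃⟩
      exact h b c h₁ h₂ h₃ rfl
    · rintro h i j h₁ h₂ h₃ ⟨⟩
      exact h ⟨h₁, h₂, h₃⟩
  rw [hpairs]
  simp only [not_or, not_and, ne_eq, Prod.mk.injEq]
end

section
/- Let A ≥ 1, n ≥ 1 be integers and let B, C, β, γ be integers. There exists a polynomial p ∈ ℚ[X,Y,Z] of total degree at most n such that p(l,i,j) = 0 for all integers l, i, j ≥ 0 with l + i + j < n, p(−A, B+i, C+j) = 0 for all integers i, j ≥ 0 with i + j < n, and p(−A−1, β, γ) ≠ 0, if and only if all of the following hold: (1) (β−B, γ−C) ≠ (i, j) for all integers i, j ≥ 1 with i + j < n; (2) (A·(β−B), A·(γ−C)) ≠ (n·B, n·C); (3a) if β−B = 0 and 0 < γ−C < n then B ≠ 0; (3b) if γ−C = 0 and 0 < β−B < n then C ≠ 0; (3c) if (β−B) + (γ−C) = n and 0 < β−B < n and 0 < γ−C < n then B + C ≠ A. -/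
open MvPolynomial

/-- The falling factorial `x (x - 1) ⋯ (x - k + 1)`. -/
def fallingFactorial (x : ℚ) (k : ℕ) : ℚ := ∏ t ∈ Finset.range k, (x - t)

@[simp]
lemma fallingFactorial_zero (x : ℚ) : fallingFactorial x 0 = 1 := by
  simp [fallingFactorial]

lemma fallingFactorial_eq_zero_iff (x : ℚ) (k : ℕ) :
    fallingFactorial x k = 0 ↔ ∃ t < k, x = t := by
  simp [fallingFactorial, Finset.prod_eq_zero_iff, sub_eq_zero]

lemma fallingFactorial_natCast_eq_zero_iff (m k : ℕ) :
    fallingFactorial m k = 0 ↔ m < k := by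
  simp [fallingFactorial_eq_zero_iff]

lemma fallingFactorial_zero_left {k : ℕ} (hk : 0 < k) : fallingFactorial 0 k = 0 := by
  simpa using (fallingFactorial_natCast_eq_zero_iff 0 k).2 hk

lemma fallingFactorial_intCast_ne_zero_iff (u : ℤ) (k : ℕ) :
    fallingFactorial u k ≠ 0 ↔ u < 0 ∨ (k : ℤ) ≤ u := by
  rw [Ne, fallingFactorial_eq_zero_iff]
  constructor
  · intro h
    by_contra! hu
    refine h ⟨u.toNat, by omega, ?_⟩
    rw [← Int.cast_natCast, Int.toNat_of_nonneg hu.1]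
  · rintro h ⟨t, ht, hut⟩
    have : u = t := by exact_mod_cast hut
    omega

lemma mul_fallingFactorial_sub_one (x : ℚ) (k : ℕ) :
    x * fallingFactorial (x - 1) k = (x - k) * fallingFactorial x k := by
  have h := Finset.prod_range_succ' (fun t : ℕ => x - t) k
  rw [Finset.prod_range_succ] at h
  simp only [fallingFactorial]
  rw [mul_comm (x - k), h, mul_comm]
  simp only [Nat.cast_zero, sub_zero, Nat.cast_add, Nat.cast_one]
  congr 1
  exact Finset.prod_congr rfl fun t _ => by ring

section Newton

variable {σ : Type*} [Fintype σ]

/-- The multivariate Newton basis polynomial with centre `s` and exponent `m`. -/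
noncomputable def newtonPoly (s : σ → ℚ) (m : σ → ℕ) : MvPolynomial σ ℚ :=
  ∏ i, ∏ t ∈ Finset.range (m i), (X i - C (s i + t))

lemma eval_newtonPoly (s x : σ → ℚ) (m : σ → ℕ) :
    eval x (newtonPoly s m) = ∏ i, fallingFactorial (x i - s i) (m i) := by
  simp [newtonPoly, fallingFactorial, sub_sub]

lemma totalDegree_newtonPoly_le (s : σ → ℚ) (m : σ → ℕ) :
    (newtonPoly s m).totalDegree ≤ ∑ i, m i := by
  refine (totalDegree_finsetProd _ _).trans (Finset.sum_le_sum fun i _ => ?_)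
  refine (totalDegree_finsetProd _ _).trans ?_
  refine (Finset.sum_le_card_nsmul _ _ 1 fun t _ => ?_).trans (by simp)
  exact (totalDegree_sub_C_le _ _).trans (totalDegree_X _).le

lemma newtonPoly_add_single [DecidableEq σ] (s : σ → ℚ) (m : σ → ℕ) (j : σ) :
    newtonPoly s (m + Pi.single j 1) = newtonPoly s m * (X j - C (s j + m j)) := by
  have h : ∀ i, ∏ t ∈ Finset.range ((m + Pi.single j 1 : σ → ℕ) i), (X i - C (s i + (t : ℚ))) =
      (∏ t ∈ Finset.range (m i), (X i - C (s i + (t : ℚ)))) *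
        if i = j then (X j - C (s j + (m j : ℚ)) : MvPolynomial σ ℚ) else 1 := by
    intro i
    by_cases hij : i = j
    · subst hij
      simp [Finset.prod_range_succ]
    · simp [hij]
  simp only [newtonPoly]
  rw [Finset.prod_congr rfl fun i _ => h i, Finset.prod_mul_distrib]
  simp

lemma X_mul_mem_span_newtonPoly (s : σ → ℚ) (n : ℕ) (j : σ) {p : MvPolynomial σ ℚ}
    (hp : p ∈ Submodule.span ℚ (newtonPoly s '' {m | ∑ i, m i ≤ n})) :
    X j * p ∈ Submodule.span ℚ (newtonPoly s '' {m | ∑ i, m i ≤ n + 1}) := by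
  classical
  induction hp using Submodule.span_induction with
  | mem p hp =>
    obtain ⟨m, hm, rfl⟩ := hp
    have h : X j * newtonPoly s m =
        newtonPoly s (m + Pi.single j 1) + (s j + m j) • newtonPoly s m := by
      rw [newtonPoly_add_single, smul_eq_C_mul]
      ring
    rw [h]
    refine add_mem (Submodule.subset_span ⟨_, ?_, rfl⟩)
      (Submodule.smul_mem _ _ (Submodule.subset_span ⟨_, ?_, rfl⟩))
    · simp only [Set.mem_ofPred_eq, Pi.add_apply, Finset.sum_add_distrib] at hm ⊢
      simpa using hm
    · exact le_trans hm (Nat.le_succ n)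
  | zero => simp
  | add p q _ _ hp hq => rw [mul_add]; exact add_mem hp hq
  | smul a p _ hp => rw [mul_smul_comm]; exact Submodule.smul_mem _ _ hp

lemma monomial_mem_span_newtonPoly (s : σ → ℚ) (d : σ →₀ ℕ) :
    monomial d (1 : ℚ) ∈ Submodule.span ℚ (newtonPoly s '' {m | ∑ i, m i ≤ d.degree}) := by
  induction d using Finsupp.induction with
  | zero =>
    refine Submodule.subset_span ⟨0, by simp, ?_⟩
    simp [newtonPoly]
  | single_add j b d _ _ ih =>
    rw [monomial_single_add, map_add, Finsupp.degree_single]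
    clear * - ih
    induction b with
    | zero => simpa using ih
    | succ b hb =>
      rw [pow_succ', mul_assoc, show b + 1 + d.degree = b + d.degree + 1 by ring]
      exact X_mul_mem_span_newtonPoly s _ j hb

lemma mem_span_newtonPoly (s : σ → ℚ) {n : ℕ} {p : MvPolynomial σ ℚ}
    (hp : p.totalDegree ≤ n) :
    p ∈ Submodule.span ℚ (newtonPoly s '' {m | ∑ i, m i ≤ n}) := by
  rw [p.as_sum]
  refine Submodule.sum_mem _ fun d hd => ?_
  rw [← mul_one (coeff d p), ← smul_eq_mul, ← smul_monomial]
  refine Submodule.smul_mem _ _ (Submodule.span_mono (Set.image_mono ?_)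
    (monomial_mem_span_newtonPoly s d))
  intro m hm
  exact le_trans hm ((le_totalDegree hd).trans hp)

lemma exists_newtonPoly_expansion (s : σ → ℚ) {n : ℕ} {p : MvPolynomial σ ℚ}
    (hp : p.totalDegree ≤ n) :
    ∃ c : (σ → ℕ) →₀ ℚ, (∀ m ∈ c.support, ∑ i, m i ≤ n) ∧
      ∑ m ∈ c.support, c m • newtonPoly s m = p := by
  obtain ⟨c, hc, h⟩ :=
    (Finsupp.mem_span_image_iff_linearCombination ℚ).1 (mem_span_newtonPoly s hp)
  exact ⟨c, fun m hm => hc hm, h⟩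

/-- The coefficients of a Newton expansion vanish on a lower set of exponents as soon as
the polynomial vanishes at the corresponding points. -/
lemma newtonPoly_coeff_eq_zero (s : σ → ℚ) (c : (σ → ℕ) →₀ ℚ) {S : Set (σ → ℕ)}
    (hS : IsLowerSet S)
    (h : ∀ m ∈ S, eval (fun i => s i + m i) (∑ m ∈ c.support, c m • newtonPoly s m) = 0) :
    ∀ m ∈ S, c m = 0 := by
  intro m
  induction m using WellFoundedLT.induction with
  | ind m ih =>
    intro hm
    have key := h m hm
    simp only [map_sum, smul_eval, eval_newtonPoly, add_sub_cancel_left] at key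
    rw [Finset.sum_eq_single m] at key
    · refine (mul_eq_zero.1 key).resolve_right (Finset.prod_ne_zero_iff.2 fun i _ => ?_)
      simp [fallingFactorial_natCast_eq_zero_iff]
    · intro k _ hk
      by_cases hkm : k ≤ m
      · rw [ih k (lt_of_le_of_ne hkm hk) (hS hkm hm), zero_mul]
      · obtain ⟨i, hi⟩ := not_forall.1 hkm
        rw [Finset.prod_eq_zero (Finset.mem_univ i), mul_zero]
        exact (fallingFactorial_natCast_eq_zero_iff _ _).2 (not_le.1 hi)
    · intro hm
      rw [Finsupp.notMem_support_iff.1 hm, zero_mul]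

/-- A polynomial of degree at most `n` vanishing on the simplex `∑ m i < n` is a combination
of Newton polynomials of degree exactly `n`. -/
lemma mem_span_newtonPoly_of_vanishing {n : ℕ} {p : MvPolynomial σ ℚ}
    (hp : p.totalDegree ≤ n)
    (h : ∀ m : σ → ℕ, ∑ i, m i < n → eval (fun i => (m i : ℚ)) p = 0) :
    p ∈ Submodule.span ℚ (newtonPoly 0 '' {m | ∑ i, m i = n}) := by
  obtain ⟨c, hc, rfl⟩ := exists_newtonPoly_expansion 0 hp
  have h0 := newtonPoly_coeff_eq_zero 0 c (S := {m | ∑ i, m i < n})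
    (fun a b hab ha => lt_of_le_of_lt (Finset.sum_le_sum fun i _ => hab i) ha)
    (fun m hm => by simpa using h m hm)
  refine Submodule.sum_mem _ fun m hm =>
    Submodule.smul_mem _ _ (Submodule.subset_span ⟨m, ?_, rfl⟩)
  exact le_antisymm (hc m hm)
    (not_lt.1 fun hlt => Finsupp.mem_support_iff.1 hm (h0 m hlt))

end Newton

/-- A discrete analogue of Euler's identity for homogeneous polynomials. -/
lemma discrete_euler {n : ℕ} {p : MvPolynomial (Fin 3) ℚ}
    (hp : p ∈ Submodule.span ℚ (newtonPoly 0 '' {m | ∑ i, m i = n})) (x y z : ℚ) :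
    x * eval ![x - 1, y, z] p + y * eval ![x, y - 1, z] p + z * eval ![x, y, z - 1] p =
      (x + y + z - n) * eval ![x, y, z] p := by
  induction hp using Submodule.span_induction with
  | mem p hp =>
    obtain ⟨m, hm, rfl⟩ := hp
    have hn : (n : ℚ) = m 0 + m 1 + m 2 := by
      rw [← (hm : _ = n), Fin.sum_univ_three]
      push_cast
      ring
    simp only [eval_newtonPoly, Fin.prod_univ_three, Matrix.cons_val, Pi.zero_apply, sub_zero]
    rw [hn]
    linear_combination
      fallingFactorial y (m 1) * fallingFactorial z (m 2) *
        mul_fallingFactorial_sub_one x (m 0) +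
      fallingFactorial x (m 0) * fallingFactorial z (m 2) *
        mul_fallingFactorial_sub_one y (m 1) +
      fallingFactorial x (m 0) * fallingFactorial y (m 1) *
        mul_fallingFactorial_sub_one z (m 2)
  | zero => simp
  | add p q _ _ hp hq => simp only [map_add]; linear_combination hp + hq
  | smul a p _ hp => simp only [smul_eval]; linear_combination a * hp

/-- The value, up to the factor `A`, at `(-A - 1, β, γ)` of the polynomial vanishing on the
simplex whose restriction to `x = -A` is the two-variable Newton polynomial with centre
`(B, C)` and exponent `(i, j)`; here `u = β - B` and `v = γ - C`. -/
def transferValue (A B C u v : ℚ) (i j : ℕ) : ℚ :=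
  (A + (i + j : ℕ) - (B + u) - (C + v)) * (fallingFactorial u i * fallingFactorial v j) +
    (B + u) * (fallingFactorial (u - 1) i * fallingFactorial v j) +
    (C + v) * (fallingFactorial u i * fallingFactorial (v - 1) j)

/-- A polynomial of degree `n` vanishing on the simplex can be prescribed on the plane
`x = -A`. -/
lemma exists_extension {A : ℚ} (hA : 0 < A) {n : ℕ} {q : MvPolynomial (Fin 3) ℚ}
    (hq : q.totalDegree ≤ n) :
    ∃ p ∈ Submodule.span ℚ (newtonPoly (σ := Fin 3) 0 '' {m | ∑ i, m i = n}),
      ∀ y z : ℚ, eval ![-A, y, z] p = eval ![-A, y, z] q := by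
  obtain ⟨c, hc, rfl⟩ := exists_newtonPoly_expansion 0 hq
  have hne : ∀ k, fallingFactorial (-A) k ≠ 0 := by
    intro k h
    obtain ⟨t, -, ht⟩ := (fallingFactorial_eq_zero_iff _ _).1 h
    have : (0 : ℚ) ≤ t := t.cast_nonneg
    linarith
  refine ⟨∑ m ∈ c.support, (c m * fallingFactorial (-A) (m 0) /
    fallingFactorial (-A) (n - m 1 - m 2)) • newtonPoly 0 ![n - m 1 - m 2, m 1, m 2],
    Submodule.sum_mem _ fun m hm => Submodule.smul_mem _ _
      (Submodule.subset_span ⟨_, ?_, rfl⟩), fun y z => ?_⟩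
  · have := hc m hm
    simp only [Fin.sum_univ_three, Set.mem_ofPred_eq, Matrix.cons_val] at this ⊢
    omega
  · simp only [map_sum, smul_eval, eval_newtonPoly, Fin.prod_univ_three, Matrix.cons_val,
      Pi.zero_apply, sub_zero]
    refine Finset.sum_congr rfl fun m _ => ?_
    have := hne (n - m 1 - m 2)
    field_simp

lemma eval_eq_zero_of_mem_span {n : ℕ} {p : MvPolynomial (Fin 3) ℚ}
    (hp : p ∈ Submodule.span ℚ (newtonPoly 0 '' {m | ∑ i, m i = n})) {l i j : ℕ}
    (h : l + i + j < n) : eval ![(l : ℚ), (i : ℚ), (j : ℚ)] p = 0 := by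
  induction hp using Submodule.span_induction with
  | mem p hp =>
    obtain ⟨m, hm, rfl⟩ := hp
    simp only [Set.mem_ofPred_eq, Fin.sum_univ_three] at hm
    simp only [eval_newtonPoly, Fin.prod_univ_three, Matrix.cons_val, Pi.zero_apply, sub_zero,
      mul_eq_zero, fallingFactorial_natCast_eq_zero_iff]
    omega
  | zero => simp
  | add p q _ _ hp hq => simp [hp, hq]
  | smul a p _ hp => simp [hp]

lemma totalDegree_le_of_mem_span {n : ℕ} {p : MvPolynomial (Fin 3) ℚ}
    (hp : p ∈ Submodule.span ℚ (newtonPoly 0 '' {m | ∑ i, m i = n})) : p.totalDegree ≤ n := by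
  induction hp using Submodule.span_induction with
  | mem p hp =>
    obtain ⟨m, hm, rfl⟩ := hp
    exact (totalDegree_newtonPoly_le 0 m).trans (le_of_eq hm)
  | zero => simp
  | add p q _ _ hp hq => exact (totalDegree_add p q).trans (max_le hp hq)
  | smul a p _ hp => exact (totalDegree_smul_le a p).trans hp

lemma exists_nonvanishing_iff_transferValue {A : ℚ} (hA : 0 < A) (n : ℕ) (B C β γ : ℚ) :
    (∃ p : MvPolynomial (Fin 3) ℚ, p.totalDegree ≤ n ∧
      (∀ l i j : ℕ, l + i + j < n → eval ![(l : ℚ), (i : ℚ), (j : ℚ)] p = 0) ∧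
      (∀ i j : ℕ, i + j < n → eval ![-A, B + (i : ℚ), C + (j : ℚ)] p = 0) ∧
      eval ![-A - 1, β, γ] p ≠ 0) ↔
    ∃ i j : ℕ, i + j = n ∧ transferValue A B C (β - B) (γ - C) i j ≠ 0 := by
  constructor
  · rintro ⟨p, hp, h3, h2, h1⟩
    by_contra! hL
    have hspan : p ∈ Submodule.span ℚ (newtonPoly 0 '' {m | ∑ i, m i = n}) := by
      refine mem_span_newtonPoly_of_vanishing hp fun m hm => ?_
      rw [Fin.sum_univ_three] at hm
      rw [← h3 _ _ _ hm]
      congr 2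
      ext i
      fin_cases i <;> rfl
    have hE := discrete_euler hspan (-A) β γ
    obtain ⟨c, hc, hcp⟩ := exists_newtonPoly_expansion ![-A, B, C] hp
    have h0 : ∀ m ∈ {m : Fin 3 → ℕ | m 0 = 0 ∧ m 1 + m 2 < n}, c m = 0 := by
      refine newtonPoly_coeff_eq_zero ![-A, B, C] c ?_ ?_
      · rintro a b hab ⟨ha, ha'⟩
        exact ⟨Nat.le_zero.1 (ha ▸ hab 0),
          lt_of_le_of_lt (Nat.add_le_add (hab 1) (hab 2)) ha'⟩
      · rintro m ⟨hm, hm'⟩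
        rw [hcp, ← h2 _ _ hm']
        congr 2
        ext i
        fin_cases i <;> simp [hm]
    have hsum : (A + n - β - γ) * eval ![-A, β, γ] p + β * eval ![-A, β - 1, γ] p +
        γ * eval ![-A, β, γ - 1] p = 0 := by
      rw [← hcp]
      simp only [map_sum, Finset.mul_sum, ← Finset.sum_add_distrib]
      refine Finset.sum_eq_zero fun m hm => ?_
      simp only [smul_eval, eval_newtonPoly, Fin.prod_univ_three, Matrix.cons_val, sub_self]
      rcases Nat.eq_zero_or_pos (m 0) with hm0 | hm0
      · have hmn : m 1 + m 2 = n := by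
          have hle := hc m hm
          rw [Fin.sum_univ_three] at hle
          have hge := not_lt.1 fun hlt => Finsupp.mem_support_iff.1 hm (h0 m ⟨hm0, hlt⟩)
          omega
        have := hL _ _ hmn
        rw [transferValue, hmn] at this
        rw [hm0, fallingFactorial_zero, sub_right_comm β 1 B, sub_right_comm γ 1 C]
        linear_combination c m * this
      · rw [fallingFactorial_zero_left hm0]
        ring
    refine h1 ((mul_eq_zero.1 (?_ : A * _ = 0)).resolve_left hA.ne')
    linear_combination hsum - hE
  · rintro ⟨i, j, rfl, hL⟩
    have hq := totalDegree_newtonPoly_le ![0, B, C] ![0, i, j]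
    simp only [Fin.sum_univ_three, Matrix.cons_val, zero_add] at hq
    obtain ⟨p, hp, hpq⟩ := exists_extension hA hq
    refine ⟨p, totalDegree_le_of_mem_span hp, fun l i j => eval_eq_zero_of_mem_span hp,
      fun k l hkl => ?_, fun h => hL ?_⟩
    · simp only [hpq, eval_newtonPoly, Fin.prod_univ_three, Matrix.cons_val, sub_zero,
        add_sub_cancel_left, mul_eq_zero, fallingFactorial_natCast_eq_zero_iff]
      omega
    · have hE := discrete_euler hp (-A) β γ
      rw [h] at hE
      simp only [hpq, eval_newtonPoly, Fin.prod_univ_three, Matrix.cons_val, sub_zero,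
        fallingFactorial_zero, sub_right_comm _ (1 : ℚ)] at hE
      rw [transferValue]
      linear_combination hE

lemma transferValue_eq (A B C u v : ℚ) (i j : ℕ) :
    u * v * transferValue A B C u v i j =
      fallingFactorial u i * fallingFactorial v j * (A * u * v - B * i * v - C * u * j) := by
  rw [transferValue]
  push_cast
  linear_combination
    (B + u) * v * fallingFactorial v j * mul_fallingFactorial_sub_one u i +
    (C + v) * u * fallingFactorial u i * mul_fallingFactorial_sub_one v j

lemma transferValue_swap (A B C u v : ℚ) (i j : ℕ) :
    transferValue A C B v u j i = transferValue A B C u v i j := by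
  simp only [transferValue, Nat.add_comm j i]
  ring

lemma fallingFactorial_neg_one_ne_zero (k : ℕ) : fallingFactorial (-1) k ≠ 0 := by
  have := (fallingFactorial_intCast_ne_zero_iff (-1) k).2 (by simp)
  simpa using this

lemma transferValue_zero_left {i : ℕ} (hi : 0 < i) (A B C v : ℚ) (j : ℕ) :
    transferValue A B C 0 v i j = B * fallingFactorial (-1) i * fallingFactorial v j := by
  simp [transferValue, fallingFactorial_zero_left hi, mul_assoc]

lemma mul_transferValue_zero_left (A B C v : ℚ) (n : ℕ) :
    v * transferValue A B C 0 v 0 n = fallingFactorial v n * (A * v - n * C) := by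
  rw [transferValue]
  simp only [fallingFactorial_zero, zero_add, one_mul]
  linear_combination (C + v) * mul_fallingFactorial_sub_one v n

lemma transferValue_ne_zero_iff (A B C : ℤ) {u v : ℤ} (hu : u ≠ 0) (hv : v ≠ 0) (i j : ℕ) :
    transferValue A B C u v i j ≠ 0 ↔
      (u < 0 ∨ (i : ℤ) ≤ u) ∧ (v < 0 ∨ (j : ℤ) ≤ v) ∧
        A * u * v - B * i * v - C * u * j ≠ 0 := by
  have huv : (u : ℚ) * v ≠ 0 := by exact_mod_cast mul_ne_zero hu hv
  rw [← fallingFactorial_intCast_ne_zero_iff, ← fallingFactorial_intCast_ne_zero_iff,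
    ← mul_ne_zero_iff_right huv, mul_comm _ ((u : ℚ) * v), transferValue_eq, mul_ne_zero_iff,
    mul_ne_zero_iff, and_assoc]
  norm_cast

lemma exists_transferValue_ne_zero_iff_of_ne_zero (A B C : ℤ) {n : ℕ} (hn : 1 ≤ n) {u v : ℤ}
    (hu : u ≠ 0) (hv : v ≠ 0) :
    (∃ i j : ℕ, i + j = n ∧ transferValue A B C u v i j ≠ 0) ↔
      ¬ (0 < u ∧ 0 < v ∧ u + v < n) ∧ ¬ (A * u = n * B ∧ A * v = n * C) ∧
        (u + v = n → 0 < u → 0 < v → B + C ≠ A) := by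
  simp only [transferValue_ne_zero_iff A B C hu hv]
  constructor
  · rintro ⟨i, j, hij, hi, hj, h⟩
    refine ⟨by omega, fun ⟨h1, h2⟩ => h ?_, fun huv hu' hv' hABC => h ?_⟩
    · have hn' : (n : ℤ) ≠ 0 := by omega
      refine (mul_eq_zero.1 (?_ : (n : ℤ) * _ = 0)).resolve_left hn'
      have : (n : ℤ) = i + j := by exact_mod_cast hij.symm
      linear_combination i * v * h1 + u * j * h2 + A * u * v * this
    · have hi' : (i : ℤ) = u := by omega
      have hj' : (j : ℤ) = v := by omega
      rw [hi', hj', ← hABC]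
      ring
  · rintro ⟨h1, h2, h3⟩
    by_contra! H
    by_cases huv : u + v = n ∧ 0 < u ∧ 0 < v
    · obtain ⟨huv, hu', hv'⟩ := huv
      have := H u.toNat v.toNat (by omega) (by omega) (by omega)
      rw [Int.toNat_of_nonneg hu'.le, Int.toNat_of_nonneg hv'.le] at this
      refine h3 huv hu' hv' ?_
      refine mul_left_cancel₀ (mul_ne_zero hu hv) ?_
      linear_combination -this
    · obtain ⟨i, j, hij, hi, hj⟩ : ∃ i j : ℕ, i + j + 1 = n ∧
          (u < 0 ∨ (i : ℤ) + 1 ≤ u) ∧ (v < 0 ∨ (j : ℤ) + 1 ≤ v) := by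
        rcases lt_or_gt_of_ne hv with hv' | hv'
        · exact ⟨0, n - 1, by omega, by omega, by omega⟩
        · refine ⟨n - v.toNat, n - 1 - (n - v.toNat), by omega, by omega, by omega⟩
      have e1 := H i (j + 1) (by omega) (by omega) (by omega)
      have e2 := H (i + 1) j (by omega) (by omega) (by omega)
      have hn' : (n : ℤ) = i + j + 1 := by exact_mod_cast hij.symm
      push_cast at e1 e2
      refine h2 ⟨mul_left_cancel₀ hv ?_, mul_left_cancel₀ hu ?_⟩
      · rw [hn']
        linear_combination (-(j : ℤ)) * e1 + (j + 1 : ℤ) * e2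
      · rw [hn']
        linear_combination (i + 1 : ℤ) * e1 - (i : ℤ) * e2

lemma exists_transferValue_zero_left_ne_zero_iff (A B C : ℤ) {n : ℕ} (hn : 1 ≤ n) {v : ℤ}
    (hv : v ≠ 0) :
    (∃ i j : ℕ, i + j = n ∧ transferValue A B C (0 : ℤ) v i j ≠ 0) ↔
      ¬ (0 = n * B ∧ A * v = n * C) ∧ (0 < v → v < n → B ≠ 0) := by
  have h0 : transferValue A B C 0 v 0 n ≠ 0 ↔ (v < 0 ∨ (n : ℤ) ≤ v) ∧ A * v ≠ n * C := by
    have hv' : (v : ℚ) ≠ 0 := by exact_mod_cast hv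
    rw [← fallingFactorial_intCast_ne_zero_iff, ← mul_ne_zero_iff_right hv', mul_comm _ (v : ℚ),
      mul_transferValue_zero_left, mul_ne_zero_iff, sub_ne_zero]
    norm_cast
  rw [Int.cast_zero]
  by_cases hB : B = 0
  · subst hB
    have : (∃ i j : ℕ, i + j = n ∧ transferValue A (0 : ℤ) C 0 v i j ≠ 0) ↔
        transferValue A (0 : ℤ) C 0 v 0 n ≠ 0 := by
      constructor
      · rintro ⟨i, j, hij, h⟩
        rcases Nat.eq_zero_or_pos i with rfl | hi
        · rwa [← hij, zero_add]
        · simp [transferValue_zero_left hi] at h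
      · exact fun h => ⟨0, n, zero_add n, h⟩
    rw [this, h0]
    simp only [mul_zero, true_and, ne_eq, not_true_eq_false]
    rw [and_comm]
    refine and_congr_right' ?_
    clear this h0
    exact ⟨fun h h1 h2 => by omega, fun h => by by_contra hc; exact h (by omega) (by omega)⟩
  · refine iff_of_true ⟨n, 0, add_zero n, ?_⟩ ⟨fun h => ?_, fun _ _ => hB⟩
    · rw [transferValue_zero_left hn]
      simpa [hB] using fallingFactorial_neg_one_ne_zero n
    · have : (n : ℤ) ≠ 0 := by omega
      exact mul_ne_zero this hB h.1.symm

lemma exists_transferValue_zero_zero_ne_zero_iff (A B C : ℚ) {n : ℕ} (hn : 1 ≤ n) :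
    (∃ i j : ℕ, i + j = n ∧ transferValue A B C 0 0 i j ≠ 0) ↔ ¬ (B = 0 ∧ C = 0) := by
  constructor
  · rintro ⟨i, j, hij, h⟩ ⟨rfl, rfl⟩
    rcases Nat.eq_zero_or_pos i with rfl | hi
    · rw [← transferValue_swap, transferValue_zero_left (by omega)] at h
      simp at h
    · simp [transferValue_zero_left hi] at h
  · intro h
    by_cases hB : B = 0
    · refine ⟨0, n, zero_add n, ?_⟩
      rw [← transferValue_swap, transferValue_zero_left hn]
      simpa [show C ≠ 0 from fun hC => h ⟨hB, hC⟩] using fallingFactorial_neg_one_ne_zero n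
    · refine ⟨n, 0, add_zero n, ?_⟩
      rw [transferValue_zero_left hn]
      simpa [hB] using fallingFactorial_neg_one_ne_zero n

lemma exists_transferValue_ne_zero_iff (A B C : ℤ) {n : ℕ} (hn : 1 ≤ n) (u v : ℤ) :
    (∃ i j : ℕ, i + j = n ∧ transferValue A B C u v i j ≠ 0) ↔
      ¬ (0 < u ∧ 0 < v ∧ u + v < n) ∧ ¬ (A * u = n * B ∧ A * v = n * C) ∧
        (u = 0 → 0 < v → v < n → B ≠ 0) ∧ (v = 0 → 0 < u → u < n → C ≠ 0) ∧
        (u + v = n → 0 < u → 0 < v → B + C ≠ A) := by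
  by_cases hu : u = 0
  · subst hu
    by_cases hv : v = 0
    · subst hv
      rw [Int.cast_zero, exists_transferValue_zero_zero_ne_zero_iff _ _ _ hn]
      have hn0 : n ≠ 0 := by omega
      simp [hn0]
    · rw [exists_transferValue_zero_left_ne_zero_iff A B C hn hv]
      simp [hv]
  · by_cases hv : v = 0
    · subst hv
      have hswap : (∃ i j : ℕ, i + j = n ∧ transferValue A B C u (0 : ℤ) i j ≠ 0) ↔
          ∃ i j : ℕ, i + j = n ∧ transferValue A C B (0 : ℤ) u i j ≠ 0 := by
        rw [exists_comm]
        simp only [transferValue_swap, Nat.add_comm]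
      rw [hswap, exists_transferValue_zero_left_ne_zero_iff A C B hn hu]
      simp [hu, and_comm]
    · rw [exists_transferValue_ne_zero_iff_of_ne_zero A B C hn hu hv]
      simp [hu, hv]

/-- Three-dimensional nonvanishing criterion: for integers `A ≥ 1`, `n ≥ 1`, `B`, `C`,
`β`, `γ`, there exists `p ∈ ℚ[X,Y,Z]` of total degree at most `n` vanishing on
`T_3 = {(l,i,j) : l,i,j ≥ 0, l+i+j < n}` and `T_2 = {(−A, B+i, C+j) : i,j ≥ 0, i+j < n}`
but not at `(−A−1, β, γ)`, if and only if conditions (1), (2), (3a), (3b), (3c) hold. -/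
theorem stmt13 (A : ℤ) (hA : 1 ≤ A) (n : ℕ) (hn : 1 ≤ n) (B C β γ : ℤ) :
    (∃ p : MvPolynomial (Fin 3) ℚ, p.totalDegree ≤ n ∧
      (∀ l i j : ℕ, l + i + j < n → eval ![(l : ℚ), (i : ℚ), (j : ℚ)] p = 0) ∧
      (∀ i j : ℕ, i + j < n →
        eval ![-(A : ℚ), (B : ℚ) + (i : ℚ), (C : ℚ) + (j : ℚ)] p = 0) ∧
      eval ![-(A : ℚ) - 1, (β : ℚ), (γ : ℚ)] p ≠ 0) ↔
    ((∀ i j : ℤ, 1 ≤ i → 1 ≤ j → i + j < (n : ℤ) → (β - B, γ - C) ≠ (i, j)) ∧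
      (A * (β - B), A * (γ - C)) ≠ ((n : ℤ) * B, (n : ℤ) * C) ∧
      (β - B = 0 → 0 < γ - C → γ - C < (n : ℤ) → B ≠ 0) ∧
      (γ - C = 0 → 0 < β - B → β - B < (n : ℤ) → C ≠ 0) ∧
      ((β - B) + (γ - C) = (n : ℤ) → 0 < β - B → β - B < (n : ℤ) →
        0 < γ - C → γ - C < (n : ℤ) → B + C ≠ A)) := by

  have h := exists_nonvanishing_iff_transferValue (A := A) (by exact_mod_cast hA) n B C β γ
  have h' := exists_transferValue_ne_zero_iff A B C hn (β - B) (γ - C)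
  push_cast at h'
  rw [h, h']
  simp only [ne_eq, Prod.mk.injEq]
  refine and_congr ⟨fun H i j hi hj hij hu => H (by omega), fun H hu =>
    H _ _ hu.1 hu.2.1 hu.2.2 ⟨rfl, rfl⟩⟩ (and_congr_right' (and_congr_right' (and_congr_right' ?_)))
  exact ⟨fun H hs hu _ hv _ => H hs hu hv, fun H hs hu hv => H hs hu (by omega) hv (by omega)⟩
end

section
/- Let a, b, c₁, c₂, e, f, g₁, g₂ be positive integers with e·a + f·b = g₁·c₁ = g₂·c₂; call this common value d. Assume gcd(e, f, g₁) = gcd(e, f, g₂) = gcd(g₁, g₂) = 1. Then the assignment sending a pair of integers (δ₁, δ₂) to (u, v, w₁, w₂), where u = (b + (δ₁·g₂ + δ₂·g₁)·e)/(g₁·g₂), v = (−a + (δ₁·g₂ + δ₂·g₁)·f)/(g₁·g₂), w₁ = −δ₁, w₂ = −δ₂, defines a bijection from the set of pairs of integers (δ₁, δ₂) with δ₁ ≤ 0, δ₂ ≤ 0 such that both (b + (δ₁·g₂ + δ₂·g₁)·e)/(g₁·g₂) and (a − (δ₁·g₂ + δ₂·g₁)·f)/(g₁·g₂) are nonnegative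 integers, onto the set of quadruples of integers (u, v, w₁, w₂) with u ≥ 0, w₁ ≥ 0, w₂ ≥ 0, v ≤ 0, g₁·g₂·(f·u − e·v) = d, and a·u + b·v + c₁·w₁ + c₂·w₂ = 0. -/
/-- Parametrization of the slice `m·x_L + 1` for `ℙ(a,b,c₁,c₂)` with relation
`(e,f,g₁,g₂)` in degree `d`: the map
`(δ₁, δ₂) ↦ ((b + (δ₁g₂ + δ₂g₁)e)/(g₁g₂), (−a + (δ₁g₂ + δ₂g₁)f)/(g₁g₂), −δ₁, −δ₂)`
is a bijection from the set of nonpositive integer pairs `(δ₁, δ₂)` such that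
`(b + (δ₁g₂ + δ₂g₁)e)/(g₁g₂)` and `(a − (δ₁g₂ + δ₂g₁)f)/(g₁g₂)` are nonnegative
integers, onto the set of integer quadruples `(u, v, w₁, w₂)` with `u, w₁, w₂ ≥ 0`,
`v ≤ 0`, `g₁g₂(fu − ev) = d` and `au + bv + c₁w₁ + c₂w₂ = 0`. -/
theorem stmt16 (a b c₁ c₂ e f g₁ g₂ d : ℤ)
    (ha : 0 < a) (hb : 0 < b) (hc₁ : 0 < c₁) (hc₂ : 0 < c₂)
    (he : 0 < e) (hf : 0 < f) (hg₁ : 0 < g₁) (hg₂ : 0 < g₂)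
    (hd : e * a + f * b = d) (hd₁ : g₁ * c₁ = d) (hd₂ : g₂ * c₂ = d)
    (hgcd₁ : Int.gcd e (Int.gcd f g₁) = 1)
    (hgcd₂ : Int.gcd e (Int.gcd f g₂) = 1)
    (hgcd₃ : Int.gcd g₁ g₂ = 1) :
    Set.BijOn
      (fun δ : ℤ × ℤ =>
        ((b + (δ.1 * g₂ + δ.2 * g₁) * e) / (g₁ * g₂),
          (-a + (δ.1 * g₂ + δ.2 * g₁) * f) / (g₁ * g₂), -δ.1, -δ.2))
      {δ : ℤ × ℤ | δ.1 ≤ 0 ∧ δ.2 ≤ 0 ∧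
        g₁ * g₂ ∣ b + (δ.1 * g₂ + δ.2 * g₁) * e ∧
        0 ≤ (b + (δ.1 * g₂ + δ.2 * g₁) * e) / (g₁ * g₂) ∧
        g₁ * g₂ ∣ a - (δ.1 * g₂ + δ.2 * g₁) * f ∧
        0 ≤ (a - (δ.1 * g₂ + δ.2 * g₁) * f) / (g₁ * g₂)}
      {q : ℤ × ℤ × ℤ × ℤ | 0 ≤ q.1 ∧ q.2.1 ≤ 0 ∧ 0 ≤ q.2.2.1 ∧ 0 ≤ q.2.2.2 ∧
        g₁ * g₂ * (f * q.1 - e * q.2.1) = d ∧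
        a * q.1 + b * q.2.1 + c₁ * q.2.2.1 + c₂ * q.2.2.2 = 0} := by
  have hG : 0 < g₁ * g₂ := mul_pos hg₁ hg₂
  have hd_pos : 0 < d := by rw [← hd₁]; positivity
  refine ⟨?_, ?_, ?_⟩
  · rintro ⟨x, y⟩ ⟨hx, hy, ⟨u, hu⟩, hu_nonneg, ⟨v, hv⟩, hv_nonneg⟩
    dsimp only at hx hy hu hv hu_nonneg hv_nonneg
    have hv' : -a + (x * g₂ + y * g₁) * f = g₁ * g₂ * -v := by linear_combination -hv
    rw [hu, Int.mul_ediv_cancel_left _ hG.ne'] at hu_nonneg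
    rw [hv, Int.mul_ediv_cancel_left _ hG.ne'] at hv_nonneg
    simp only [Set.mem_ofPred_eq, hu, hv', Int.mul_ediv_cancel_left _ hG.ne']
    refine ⟨hu_nonneg, by lia, by lia, by lia, ?_, ?_⟩
    · linear_combination -f * hu - e * hv + hd
    · refine (mul_eq_zero.mp ?_).resolve_left hG.ne'
      linear_combination -a * hu + b * hv + (x * g₂ + y * g₁) * hd - g₂ * x * hd₁ - g₁ * y * hd₂
  · rintro ⟨x, y⟩ - ⟨x', y'⟩ - h
    simp only [Prod.mk.injEq, neg_inj] at h
    exact Prod.ext h.2.2.1 h.2.2.2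
  · rintro ⟨u, v, w, z⟩ ⟨hu, hv, hw, hz, hslice, hdeg⟩
    dsimp only at hu hv hw hz hslice hdeg
    have hU : b + (-w * g₂ + -z * g₁) * e = g₁ * g₂ * u := by
      refine mul_left_cancel₀ hd_pos.ne' ?_
      linear_combination -b * hslice - e * g₁ * g₂ * hdeg + (e * g₂ * w) * hd₁
        + (e * g₁ * z) * hd₂ + (g₁ * g₂ * u) * hd
    have hV : -a + (-w * g₂ + -z * g₁) * f = g₁ * g₂ * v := by
      refine mul_left_cancel₀ hd_pos.ne' ?_
      linear_combination a * hslice - f * g₁ * g₂ * hdeg + (f * g₂ * w) * hd₁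
        + (f * g₁ * z) * hd₂ + (g₁ * g₂ * v) * hd
    have hV' : a - (-w * g₂ + -z * g₁) * f = g₁ * g₂ * -v := by linear_combination -hV
    refine ⟨(-w, -z), ⟨by simpa using hw, by simpa using hz, ?_⟩, ?_⟩
    · simp only [hU, hV', Int.mul_ediv_cancel_left _ hG.ne']
      exact ⟨dvd_mul_right _ _, hu, dvd_mul_right _ _, by lia⟩
    · simp only [hU, hV, Int.mul_ediv_cancel_left _ hG.ne', neg_neg]
end
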